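/- Let T be a minimal interval exchange transformation on [ℓ,r) defined over ℤ[√d]. There exist constants 0 < c₁ ≤ c₂ (depending only on T) such that for every semi-interval J ⊆ [ℓ,r) with endpoints in ℤ[√d], each of the four quantities ρ⁺(J), ρ⁻(J), σ⁺(J), σ⁻(J) lies between c₁/|J| and c₂/|J|; in particular ρ⁺(J) = Θ(ρ⁻(J)) = Θ(σ⁺(J)) = Θ(σ⁻(J)) = Θ(1/|J|). -/

import Mathlib

open Set MeasureTheory

noncomputable section

/-- Left endpoint `γ i` of the `i`-th exchanged semi-interval. -/
def sepPt {s : ℕ} (l : ℝ) (len : Fin s → ℝ) (i : Fin s) : ℝ :=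
  l + ∑ j ∈ Finset.univ.filter (fun j => j < i), len j

/-- Left endpoint `δ` of the image of the `i`-th exchanged semi-interval. -/
def imgPt {s : ℕ} (l : ℝ) (len : Fin s → ℝ) (π : Equiv.Perm (Fin s)) (i : Fin s) : ℝ :=
  l + ∑ j ∈ Finset.univ.filter (fun j => π j < π i), len j

/-- `T` is the `s`-interval exchange transformation on `[l,r)` with lengths `len`
and permutation `π`, extended by the identity outside `[l,r)`. -/
def IsIET (s : ℕ) (l r : ℝ) (len : Fin s → ℝ) (π : Equiv.Perm (Fin s))
    (T : Equiv.Perm ℝ) : Prop :=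
  l < r ∧ (∀ i, 0 < len i) ∧ (∑ i, len i) = r - l ∧
  (∀ z, z ∉ Set.Ico l r → T z = z) ∧
  ∀ i : Fin s, ∀ z ∈ Set.Ico (sepPt l len i) (sepPt l len i + len i),
    T z = z + (imgPt l len π i - sepPt l len i)

/-- The two-sided orbit `{T^n z : n ∈ ℤ}`. -/
def orbitZ (T : Equiv.Perm ℝ) (z : ℝ) : Set ℝ := {w | ∃ n : ℤ, (T ^ n) z = w}

/-- Regularity (idoc): the orbits of the nonzero separation points are infinite
and pairwise disjoint. -/
def IsRegularIET (s : ℕ) (l : ℝ) (len : Fin s → ℝ) (T : Equiv.Perm ℝ) : Prop :=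
  (∀ i : Fin s, (i : ℕ) ≠ 0 → (orbitZ T (sepPt l len i)).Infinite) ∧
  (∀ i j : Fin s, (i : ℕ) ≠ 0 → (j : ℕ) ≠ 0 → i ≠ j →
    Disjoint (orbitZ T (sepPt l len i)) (orbitZ T (sepPt l len j)))

/-- Minimality: every (two-sided) orbit of a point of `[l,r)` is dense in `[l,r)`. -/
def IsMinimalOn (T : Equiv.Perm ℝ) (l r : ℝ) : Prop :=
  ∀ z ∈ Set.Ico l r, Set.Ico l r ⊆ closure (orbitZ T z)

/-- First return time of `z` in `I` (defined via `sInf`; meaningful when `T` is minimal). -/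
def returnTime (T : Equiv.Perm ℝ) (I : Set ℝ) (z : ℝ) : ℕ :=
  sInf {n : ℕ | 0 < n ∧ (T ^ n) z ∈ I}

/-- The transformation induced by `T` on `I` (first-return map). -/
def inducedMap (T : Equiv.Perm ℝ) (I : Set ℝ) (z : ℝ) : ℝ :=
  (T ^ returnTime T I z) z

/-- The transformation induced by `T` on `[u,v)` is an interval exchange
transformation on `k` intervals with data `(lam, σ)`. -/
def InducedData (T : Equiv.Perm ℝ) (u v : ℝ) (k : ℕ) (lam : Fin k → ℝ)
    (σ : Equiv.Perm (Fin k)) : Prop :=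
  ∃ S : Equiv.Perm ℝ, IsIET k u v lam σ S ∧
    ∀ z ∈ Set.Ico u v, S z = inducedMap T (Set.Ico u v) z

/-- The semi-interval `[l,t)` is right admissible for `T`. -/
def RightAdmissible (s : ℕ) (l r : ℝ) (len : Fin s → ℝ) (T : Equiv.Perm ℝ)
    (t : ℝ) : Prop :=
  l < t ∧ t < r ∧ ∃ (i : Fin s) (k : ℤ), t = (T ^ k) (sepPt l len i) ∧
    (0 < k → ∀ h : ℤ, 0 < h → h < k → t < (T ^ h) (sepPt l len i)) ∧
    (k ≤ 0 → ∀ h : ℤ, k < h → h ≤ 0 → t < (T ^ h) (sepPt l len i))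

/-- `ρ⁺_{I,T}(z) = min {n > 0 : T^n z ∈ (u,v)}`. -/
def rhoPlusPt (T : Equiv.Perm ℝ) (u v z : ℝ) : ℕ :=
  sInf {n : ℕ | 0 < n ∧ (T ^ n) z ∈ Set.Ioo u v}

/-- `ρ⁻_{I,T}(z) = min {n ≥ 0 : T^{-n} z ∈ (u,v)}`. -/
def rhoMinusPt (T : Equiv.Perm ℝ) (u v z : ℝ) : ℕ :=
  sInf {n : ℕ | (T⁻¹ ^ n) z ∈ Set.Ioo u v}

/-- The set of neighbours `N_{I,T}(z)` of `z` with respect to `I = [u,v)` and `T`. -/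
def neighbours (T : Equiv.Perm ℝ) (u v z : ℝ) : Set ℝ :=
  {w | ∃ k : ℤ, -(rhoMinusPt T u v z : ℤ) ≤ k ∧ k < (rhoPlusPt T u v z : ℤ) ∧
    w = (T ^ k) z}

/-- The set of division points `Div(I,T)` of `I = [u,v)` with respect to `T`. -/
def divPoints (s : ℕ) (l : ℝ) (len : Fin s → ℝ) (T : Equiv.Perm ℝ)
    (u v : ℝ) : Set ℝ :=
  ⋃ i : Fin s, neighbours T u v (sepPt l len i)

/-- The semi-interval `[u,v) ⊆ [l,r)` is admissible for `T`. -/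
def Admissible (s : ℕ) (l r : ℝ) (len : Fin s → ℝ) (T : Equiv.Perm ℝ)
    (u v : ℝ) : Prop :=
  l ≤ u ∧ u < v ∧ v ≤ r ∧
  u ∈ divPoints s l len T u v ∪ {r} ∧ v ∈ divPoints s l len T u v ∪ {r}

/-- A bundled regular `s`-interval exchange transformation. -/
structure RIET (s : ℕ) where
  l : ℝ
  r : ℝ
  len : Fin s → ℝ
  perm : Equiv.Perm (Fin s)
  T : Equiv.Perm ℝ
  isIET : IsIET s l r len perm T
  isReg : IsRegularIET s l len T

/-- The right endpoint `max (γ_s, δ_{π(s)})` of `Z(T)`. -/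
def zPoint {s : ℕ} (X : RIET s) : ℝ :=
  if h : 0 < s then
    max (sepPt X.l X.len ⟨s - 1, by omega⟩)
      (imgPt X.l X.len X.perm (X.perm.symm ⟨s - 1, by omega⟩))
  else X.r

/-- The left endpoint `min (γ_2, δ_{π(2)})` of `Y(T)`. -/
def yPoint {s : ℕ} (X : RIET s) : ℝ :=
  if h : 1 < s then
    min (sepPt X.l X.len ⟨1, h⟩) (imgPt X.l X.len X.perm (X.perm.symm ⟨1, h⟩))
  else X.l

/-- `Y = ψ(X)`: one step of the right Rauzy induction. -/
def PsiStep {s : ℕ} (X Y : RIET s) : Prop :=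
  Y.l = X.l ∧ Y.r = zPoint X ∧
  ∀ z ∈ Set.Ico X.l (zPoint X), Y.T z = inducedMap X.T (Set.Ico X.l (zPoint X)) z

/-- `Y = φ(X)`: one step of the left Rauzy induction. -/
def PhiStep {s : ℕ} (X Y : RIET s) : Prop :=
  Y.l = yPoint X ∧ Y.r = X.r ∧
  ∀ z ∈ Set.Ico (yPoint X) X.r, Y.T z = inducedMap X.T (Set.Ico (yPoint X) X.r) z

/-- Equivalence of two `s`-interval exchange transformations: `(σ, mu)` is obtained
from `(π, lam)` by rescaling, possibly combined with the reversal `τ : i ↦ s - i + 1`. -/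
def IETEquiv (s : ℕ) (π σ : Equiv.Perm (Fin s)) (lam mu : Fin s → ℝ) : Prop :=
  (∃ c : ℝ, 0 < c ∧ σ = π ∧ ∀ i, mu i = c * lam i) ∨
  (∃ c : ℝ, 0 < c ∧ (∀ i, σ i = (π i).rev) ∧ ∀ i, mu i = c * lam i.rev)

/-- The subring `ℤ[√d]` of `ℝ`. -/
def Zsd (d : ℤ) : Set ℝ := {z | ∃ m n : ℤ, z = (m : ℝ) + (n : ℝ) * Real.sqrt d}

/-- `Ψ(z) = max (|m|,|n|)` for `z = m + n√d` (the representation being unique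
when `d ≥ 2` is squarefree). -/
def PsiNum (d : ℤ) (z : ℝ) : ℕ :=
  sInf {k : ℕ | ∃ m n : ℤ, z = (m : ℝ) + (n : ℝ) * Real.sqrt d ∧
    k = max m.natAbs n.natAbs}

/-- `Ψ(S) = max {Ψ(z) : z ∈ ∂S}`. -/
def PsiSet (d : ℤ) (S : Set ℝ) : ℕ := sSup (PsiNum d '' frontier S)

/-- The reduced complexity `Π(S) = |S| ⬝ Ψ(S)`. -/
def PiSet (d : ℤ) (S : Set ℝ) : ℝ := (volume S).toReal * PsiSet d S

/-- `S` belongs to the algebra `A([l,r))`: a nonempty finite union of semi-intervals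
of `[l,r)` with endpoints in `ℤ[√d]`. -/
def MemA (d : ℤ) (l r : ℝ) (S : Set ℝ) : Prop :=
  S.Nonempty ∧ S ⊆ Set.Ico l r ∧
  ∃ (k : ℕ) (a b : Fin k → ℝ), (∀ j, a j ∈ Zsd d ∧ b j ∈ Zsd d ∧ a j < b j) ∧
    S = ⋃ j, Set.Ico (a j) (b j)

/-- The interval exchange transformation with data `(l, r, len, π)` is defined over
`ℤ[√d]`: `l`, `r`, the separation points and the translation values lie in `ℤ[√d]`. -/
def DefinedOverZ (d : ℤ) (s : ℕ) (l r : ℝ) (len : Fin s → ℝ)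
    (π : Equiv.Perm (Fin s)) : Prop :=
  l ∈ Zsd d ∧ r ∈ Zsd d ∧
  ∀ i, sepPt l len i ∈ Zsd d ∧ (imgPt l len π i - sepPt l len i) ∈ Zsd d

/-- Maximal positive return time `ρ⁺(S)`. -/
def rhoPlusSet (T : Equiv.Perm ℝ) (S : Set ℝ) : ℕ :=
  sInf {n : ℕ | 1 ≤ n ∧ ⇑(T ^ n) '' S ⊆ ⋃ i ∈ Finset.range n, ⇑(T ^ i) '' S}

/-- Maximal negative return time `ρ⁻(S)`. -/
def rhoMinusSet (T : Equiv.Perm ℝ) (S : Set ℝ) : ℕ :=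
  sInf {m : ℕ | 1 ≤ m ∧ ⇑(T ^ m) '' S ⊆ ⋃ i ∈ Finset.range m, ⇑(T⁻¹ ^ i) '' S}

/-- Minimal positive return time `σ⁺(S)`. -/
def sigmaPlusSet (T : Equiv.Perm ℝ) (S : Set ℝ) : ℕ :=
  sInf {n : ℕ | 1 ≤ n ∧ (⇑(T ^ n) '' S ∩ S).Nonempty}

/-- Minimal negative return time `σ⁻(S)`. -/
def sigmaMinusSet (T : Equiv.Perm ℝ) (S : Set ℝ) : ℕ :=
  sInf {m : ℕ | 1 ≤ m ∧ (⇑(T⁻¹ ^ m) '' S ∩ S).Nonempty}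

/-- `D_{m,n}(T) = ⋃_{i=-m+1}^{n} T^i (Sep(T))`. -/
def Dmn (s : ℕ) (l : ℝ) (len : Fin s → ℝ) (T : Equiv.Perm ℝ) (m n : ℕ) : Set ℝ :=
  {w | ∃ (i : Fin s) (k : ℤ), -(m : ℤ) + 1 ≤ k ∧ k ≤ (n : ℤ) ∧
    w = (T ^ k) (sepPt l len i)}

/-- `[u,v)` belongs to `U(T) = ⋃_{m,n ≥ 1} U_{m,n}(T)`: it is one of the
semi-intervals into which `D_{m,n}(T)` partitions `[l,r)`. -/
def MemU (s : ℕ) (l r : ℝ) (len : Fin s → ℝ) (T : Equiv.Perm ℝ) (u v : ℝ) : Prop :=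
  ∃ m n : ℕ, 1 ≤ m ∧ 1 ≤ n ∧ u ∈ Dmn s l len T m n ∧
    (v ∈ Dmn s l len T m n ∨ v = r) ∧ ∀ w ∈ Dmn s l len T m n, w ∉ Set.Ioo u v

/-- `x` lies in `ℤ[√d]` and has a Galois conjugate of absolute value at most `B`. -/
def ConjLe (d : ℤ) (B x : ℝ) : Prop :=
  ∃ m n : ℤ, x = m + n * √(d : ℝ) ∧ |m - n * √(d : ℝ)| ≤ B

namespace ConjLe

variable {d : ℤ} {A B x y : ℝ}

theorem mono (h : ConjLe d A x) (hAB : A ≤ B) : ConjLe d B x := by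
  obtain ⟨m, n, rfl, h⟩ := h
  exact ⟨m, n, rfl, h.trans hAB⟩

theorem intCast (d m : ℤ) : ConjLe d |(m : ℝ)| m := ⟨m, 0, by simp, by simp⟩

theorem add (hx : ConjLe d A x) (hy : ConjLe d B y) : ConjLe d (A + B) (x + y) := by
  obtain ⟨m, n, rfl, h⟩ := hx
  obtain ⟨m', n', rfl, h'⟩ := hy
  refine ⟨m + m', n + n', by push_cast; ring, ?_⟩
  have e : ((m + m' : ℤ) : ℝ) - ((n + n' : ℤ) : ℝ) * √(d : ℝ)
      = (m - n * √(d : ℝ)) + (m' - n' * √(d : ℝ)) := by push_cast; ring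
  rw [e]
  exact (abs_add_le _ _).trans (add_le_add h h')

theorem neg (hx : ConjLe d A x) : ConjLe d A (-x) := by
  obtain ⟨m, n, rfl, h⟩ := hx
  refine ⟨-m, -n, by push_cast; ring, ?_⟩
  have e : ((-m : ℤ) : ℝ) - ((-n : ℤ) : ℝ) * √(d : ℝ) = -(m - n * √(d : ℝ)) := by
    push_cast; ring
  rwa [e, abs_neg]

theorem sub (hx : ConjLe d A x) (hy : ConjLe d B y) : ConjLe d (A + B) (x - y) := by
  rw [sub_eq_add_neg]
  exact hx.add hy.neg

theorem mul (hd : 0 ≤ d) (hx : ConjLe d A x) (hy : ConjLe d B y) :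
    ConjLe d (A * B) (x * y) := by
  have hs : √(d : ℝ) * √(d : ℝ) = d := Real.mul_self_sqrt (by exact_mod_cast hd)
  obtain ⟨m, n, rfl, h⟩ := hx
  obtain ⟨m', n', rfl, h'⟩ := hy
  refine ⟨m * m' + d * n * n', m * n' + n * m', ?_, ?_⟩
  · push_cast; linear_combination ((n : ℝ) * n') * hs
  · have e : ((m * m' + d * n * n' : ℤ) : ℝ) - ((m * n' + n * m' : ℤ) : ℝ) * √(d : ℝ)
        = (m - n * √(d : ℝ)) * (m' - n' * √(d : ℝ)) := by
      push_cast; linear_combination (-(n : ℝ) * n') * hs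
    rw [e, abs_mul]
    exact mul_le_mul h h' (abs_nonneg _) ((abs_nonneg _).trans h)

theorem pow (hd : 0 ≤ d) (hx : ConjLe d A x) (k : ℕ) : ConjLe d (A ^ k) (x ^ k) := by
  induction k with
  | zero => simpa using intCast d 1
  | succ k ih => simpa only [pow_succ] using ih.mul hd hx

theorem max (hx : ConjLe d A x) (hy : ConjLe d A y) : ConjLe d A (max x y) := by
  rcases max_choice x y with h | h <;> rwa [h]

theorem min (hx : ConjLe d A x) (hy : ConjLe d A y) : ConjLe d A (min x y) := by
  rcases min_choice x y with h | h <;> rwa [h]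

/-- The norm of a nonzero element of `ℤ[√d]` is at least one in absolute value. -/
theorem one_le_abs_mul (hirr : Irrational √(d : ℝ)) (hd : 0 ≤ d) (h0 : x ≠ 0)
    (h : ConjLe d B x) : 1 ≤ |x| * B := by
  have hs : √(d : ℝ) * √(d : ℝ) = d := Real.mul_self_sqrt (by exact_mod_cast hd)
  obtain ⟨m, n, rfl, h⟩ := h
  have hc : (m : ℝ) - n * √(d : ℝ) ≠ 0 := by
    intro hc
    rcases eq_or_ne n 0 with rfl | hn
    · apply h0
      simpa using hc
    · have h1 := (hirr.intCast_mul hn).ne_int m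
      exact h1 (by linarith)
  have e : ((m : ℝ) + n * √(d : ℝ)) * (m - n * √(d : ℝ)) = ((m * m - d * n * n : ℤ) : ℝ) := by
    push_cast; linear_combination (-(n : ℝ) * n) * hs
  have hne : m * m - d * n * n ≠ 0 := by
    intro h1
    rw [h1] at e
    exact mul_ne_zero h0 hc (by simpa using e)
  have h2 : (1 : ℝ) ≤ |((m * m - d * n * n : ℤ) : ℝ)| := by
    exact_mod_cast Int.one_le_abs hne
  rw [← e, abs_mul] at h2
  exact h2.trans (mul_le_mul_of_nonneg_left h (abs_nonneg _))

theorem exists_of_mem_Zsd (h : x ∈ Zsd d) : ∃ B, ConjLe d B x := by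
  obtain ⟨m, n, h⟩ := h
  exact ⟨_, m, n, h, le_rfl⟩

end ConjLe

theorem exists_conjLe_unit {d : ℤ} (hd : 2 ≤ d) (hsq : ¬ IsSquare d) :
    ∃ y : ℝ, 1 < y ∧ ConjLe d y y⁻¹ := by
  obtain ⟨a, b, hab, hb⟩ := Pell.exists_of_not_isSquare (by omega : 0 < d) hsq
  have hs : √(d : ℝ) * √(d : ℝ) = d :=
    Real.mul_self_sqrt (by exact_mod_cast (by omega : 0 ≤ d))
  have hs0 : 0 < √(d : ℝ) := Real.sqrt_pos.2 (by exact_mod_cast (by omega : 0 < d))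
  have hb1 : (1 : ℝ) ≤ |(b : ℝ)| := by exact_mod_cast Int.one_le_abs hb
  have ha : a ≠ 0 := by
    rintro rfl
    nlinarith [mul_nonneg (by omega : 0 ≤ d) (sq_nonneg b)]
  have ha1 : (1 : ℝ) ≤ |(a : ℝ)| := by exact_mod_cast Int.one_le_abs ha
  have habR : |(a : ℝ)| ^ 2 - d * |(b : ℝ)| ^ 2 = 1 := by
    rw [sq_abs, sq_abs]; exact_mod_cast hab
  have hy : 1 < |(a : ℝ)| + |(b : ℝ)| * √(d : ℝ) := by nlinarith
  refine ⟨|(a : ℝ)| + |(b : ℝ)| * √(d : ℝ), hy, |a|, -|b|, ?_, ?_⟩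
  · refine inv_eq_of_mul_eq_one_right ?_
    push_cast
    linear_combination habR - |(b : ℝ)| ^ 2 * hs
  · push_cast
    rw [abs_of_nonneg] <;> linarith

theorem exists_conjLe_near_pow {d : ℤ} (hd : 0 ≤ d) {x y B : ℝ} (hy : 1 < y)
    (hη : ConjLe d y y⁻¹) (hB : B + y * y ≤ B * y) (hx : |x| + 1 ≤ B) (k : ℕ) :
    ∃ p, p ≤ x ∧ x < p + (y⁻¹) ^ k ∧ ConjLe d (B * y ^ k) p := by
  induction k with
  | zero =>
    refine ⟨⌊x⌋, Int.floor_le x, by simp,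
      (ConjLe.intCast d _).mono ?_⟩
    rw [pow_zero, mul_one]
    refine le_trans ?_ hx
    rw [abs_le]
    have h1 := Int.floor_le x
    have h2 := Int.lt_floor_add_one x
    constructor
    · linarith [neg_abs_le x]
    · linarith [le_abs_self x]
  | succ k ih =>
    obtain ⟨p, hp, hp', hc⟩ := ih
    have hy0 : 0 < y := by linarith
    have hyk : 0 < y ^ k := by positivity
    have hpos : 0 < (y⁻¹) ^ (k + 1) := by positivity
    set D : ℤ := ⌊(x - p) / (y⁻¹) ^ (k + 1)⌋ with hD
    have h1 : (D : ℝ) * (y⁻¹) ^ (k + 1) ≤ x - p := by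
      rw [← le_div_iff₀ hpos]; exact Int.floor_le _
    have h2 : x - p < (D + 1) * (y⁻¹) ^ (k + 1) := by
      rw [← div_lt_iff₀ hpos]; exact Int.lt_floor_add_one _
    have hD0 : (0 : ℝ) ≤ D := by
      have : 0 ≤ D := Int.floor_nonneg.2 (div_nonneg (by linarith) hpos.le)
      exact_mod_cast this
    have hDy : (D : ℝ) ≤ y := by
      by_contra! hlt
      have h3 : y * (y⁻¹) ^ (k + 1) = (y⁻¹) ^ k := by
        rw [pow_succ]; field_simp
      nlinarith
    refine ⟨p + D * (y⁻¹) ^ (k + 1), by linarith, by linarith,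
      (hc.add ((ConjLe.intCast d D).mul hd (hη.pow hd (k + 1)))).mono ?_⟩
    rw [abs_of_nonneg hD0]
    calc B * y ^ k + D * y ^ (k + 1) ≤ B * y ^ k + y * y ^ (k + 1) := by gcongr
      _ = (B + y * y) * y ^ k := by ring
      _ ≤ B * y * y ^ k := by gcongr
      _ = B * y ^ (k + 1) := by ring

/-- Elements of `ℤ[√d]` with conjugate `O(1/ε)` are `ε`-dense in a bounded interval. -/
theorem exists_conjLe_near {d : ℤ} (hd : 2 ≤ d) (hsq : ¬ IsSquare d) (l r : ℝ) :
    ∃ C, 0 < C ∧ ∀ ε, 0 < ε → ε ≤ r - l → ∀ x ∈ Set.Icc l r,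
      ∃ p, p ≤ x ∧ x < p + ε ∧ ConjLe d (C / ε) p := by
  obtain ⟨y, hy, hη⟩ := exists_conjLe_unit hd hsq
  have hy1 : 0 < y - 1 := by linarith
  set B : ℝ := y * y / (y - 1) + (|l| + |r| + 1) with hB
  have hB0 : 0 < B := by positivity
  have hBy : B + y * y ≤ B * y := by
    have h1 : y * y / (y - 1) * (y - 1) = y * y := by field_simp
    have h2 : 0 ≤ (|l| + |r| + 1) * (y - 1) := by positivity
    have h3 : B * (y - 1) = y * y / (y - 1) * (y - 1) + (|l| + |r| + 1) * (y - 1) := by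
      rw [hB]; ring
    nlinarith
  refine ⟨B * y * (1 + |r - l|), by positivity, fun ε hε hεr x hx => ?_⟩
  have hxB : |x| + 1 ≤ B := by
    have h1 : 0 ≤ y * y / (y - 1) := by positivity
    have h2 : |x| ≤ |l| + |r| := abs_le.2
      ⟨by linarith [hx.1, neg_abs_le l, abs_nonneg r],
        by linarith [hx.2, le_abs_self r, abs_nonneg l]⟩
    linarith
  have hW : ε ≤ 1 + |r - l| := by linarith [le_abs_self (r - l)]
  obtain ⟨n, hn, hn'⟩ := exists_nat_pow_near ((one_le_div hε).2 hW) hy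
  obtain ⟨p, hp, hp', hc⟩ :=
    exists_conjLe_near_pow (by omega : 0 ≤ d) hy hη hBy hxB (n + 1)
  have hn0 : 0 < y ^ (n + 1) := by positivity
  have hW1 : (1 : ℝ) ≤ 1 + |r - l| := by linarith [abs_nonneg (r - l)]
  refine ⟨p, hp, hp'.trans_le ?_, hc.mono ?_⟩
  · rw [inv_pow, add_le_add_iff_left, inv_le_comm₀ hn0 hε]
    refine le_trans ?_ hn'.le
    rw [inv_eq_one_div]
    gcongr
  · calc B * y ^ (n + 1) = B * y * y ^ n := by ring
      _ ≤ B * y * ((1 + |r - l|) / ε) := by gcongr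
      _ = B * y * (1 + |r - l|) / ε := by ring

/-- `T` preserves `[l,r)`, and each point of `[l,r)` has a semi-interval neighbourhood on which
`T` is a translation, with endpoints and translation value of bounded conjugate. -/
structure IsLocalTranslation (d : ℤ) (G M l r : ℝ) (T : Equiv.Perm ℝ) : Prop where
  mem_iff : ∀ z, T z ∈ Ico l r ↔ z ∈ Ico l r
  exists_translation : ∀ z ∈ Ico l r, ∃ a b τ, z ∈ Ico a b ∧ ConjLe d G a ∧ ConjLe d G b ∧
    ConjLe d M τ ∧ ∀ x ∈ Ico a b, T x = x + τ

theorem perm_apply_inv_self (T : Equiv.Perm ℝ) (x : ℝ) : T (T⁻¹ x) = x :=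
  T.apply_symm_apply x

theorem perm_inv_apply_self (T : Equiv.Perm ℝ) (x : ℝ) : T⁻¹ (T x) = x :=
  T.symm_apply_apply x

theorem perm_pow_succ_apply (T : Equiv.Perm ℝ) (k : ℕ) (x : ℝ) :
    (T ^ (k + 1)) x = T ((T ^ k) x) := by
  rw [pow_succ', Equiv.Perm.mul_apply]

namespace IsLocalTranslation

variable {d : ℤ} {G M l r : ℝ} {T : Equiv.Perm ℝ}

theorem mono (hT : IsLocalTranslation d G M l r T) {G' : ℝ} (h : G ≤ G') :
    IsLocalTranslation d G' M l r T := by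
  refine ⟨hT.mem_iff, fun z hz => ?_⟩
  obtain ⟨a, b, τ, h1, h2, h3, h4⟩ := hT.exists_translation z hz
  exact ⟨a, b, τ, h1, h2.mono h, h3.mono h, h4⟩

theorem inv (hT : IsLocalTranslation d G M l r T) :
    IsLocalTranslation d (G + M) M l r T⁻¹ := by
  have hmem : ∀ z, T⁻¹ z ∈ Ico l r ↔ z ∈ Ico l r := fun z => by
    rw [← hT.mem_iff (T⁻¹ z), perm_apply_inv_self]
  refine ⟨hmem, fun z hz => ?_⟩
  obtain ⟨a, b, τ, h1, h2, h3, h4, h5⟩ := hT.exists_translation _ ((hmem z).2 hz)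
  have hz' : z = T⁻¹ z + τ := by rw [← h5 _ h1, perm_apply_inv_self]
  refine ⟨a + τ, b + τ, -τ, ⟨by linarith [h1.1], by linarith [h1.2]⟩, h2.add h4, h3.add h4,
    h4.neg, fun x hx => ?_⟩
  rw [Equiv.Perm.inv_eq_iff_eq, h5 _ ⟨by linarith [hx.1], by linarith [hx.2]⟩]
  ring

theorem pow_mem_iff (hT : IsLocalTranslation d G M l r T) (k : ℕ) (z : ℝ) :
    (T ^ k) z ∈ Ico l r ↔ z ∈ Ico l r := by
  induction k with
  | zero => simp
  | succ k ih => rw [perm_pow_succ_apply, hT.mem_iff, ih]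

theorem conjLe_pow_sub (hT : IsLocalTranslation d G M l r T) {z : ℝ} (hz : z ∈ Ico l r)
    (k : ℕ) : ConjLe d (k * M) ((T ^ k) z - z) := by
  induction k with
  | zero => simpa using ConjLe.intCast d 0
  | succ k ih =>
    obtain ⟨a, b, τ, h1, h2, h3, h4, h5⟩ :=
      hT.exists_translation _ ((hT.pow_mem_iff k z).2 hz)
    rw [perm_pow_succ_apply, h5 _ h1, add_sub_right_comm]
    exact (ih.add h4).mono (by push_cast; linarith)

/-- A point of `[u,v)` which stays outside `[u,v)` up to time `k` has a semi-interval
neighbourhood with the same property, whose endpoints have conjugate `O(k)`. -/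
theorem exists_avoiding_Ico (hT : IsLocalTranslation d G M l r T) {u v z : ℝ}
    (hl : l ≤ u) (hr : v ≤ r) (hu : ConjLe d G u) (hv : ConjLe d G v) (hz : z ∈ Ico u v)
    (k : ℕ) (hk : ∀ i, 1 ≤ i → i ≤ k → (T ^ i) z ∉ Ico u v) :
    ∃ a b τ, z ∈ Ico a b ∧ Ico a b ⊆ Ico u v ∧ ConjLe d (G + k * M) a ∧
      ConjLe d (G + k * M) b ∧ ConjLe d (k * M) τ ∧ (∀ x ∈ Ico a b, (T ^ k) x = x + τ) ∧
      ∀ x ∈ Ico a b, ∀ i, 1 ≤ i → i ≤ k → (T ^ i) x ∉ Ico u v := by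
  have hzlr : z ∈ Ico l r := ⟨hl.trans hz.1, hz.2.trans_le hr⟩
  induction k with
  | zero =>
    refine ⟨u, v, 0, hz, le_rfl, by simpa using hu, by simpa using hv, ?_, by simp, ?_⟩
    · simpa using ConjLe.intCast d 0
    · intro x _ i h1 h2
      omega
  | succ k ih =>
    obtain ⟨a, b, τ, hzab, hsub, ha, hb, hτ, htr, hav⟩ :=
      ih fun i h1 h2 => hk i h1 (h2.trans k.le_succ)
    obtain ⟨a', b', τ', hzab', ha', hb', hτ', htr'⟩ :=
      hT.exists_translation _ ((hT.pow_mem_iff k z).2 hzlr)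
    have hM : 0 ≤ M := by
      obtain ⟨m, n, -, h⟩ := hτ'
      exact (abs_nonneg _).trans h
    rw [htr z hzab] at hzab'
    have hzs : (T ^ (k + 1)) z = z + τ + τ' := by
      rw [perm_pow_succ_apply, htr z hzab, htr' _ hzab']
    have hzn := hk (k + 1) (by omega) le_rfl
    rw [hzs] at hzn
    have e1 : G + k * M ≤ G + ((k + 1 : ℕ) : ℝ) * M := by push_cast; linarith
    have e2 : k * M + M ≤ ((k + 1 : ℕ) : ℝ) * M := by push_cast; linarith
    have e3 : G + (k * M + M) ≤ G + ((k + 1 : ℕ) : ℝ) * M := by linarith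
    have hττ := hτ.add hτ'
    have hA : ConjLe d (G + ((k + 1 : ℕ) : ℝ) * M) (max a (a' - τ)) :=
      ((ha.max (ha'.sub hτ))).mono e1
    have hB : ConjLe d (G + ((k + 1 : ℕ) : ℝ) * M) (min b (b' - τ)) :=
      ((hb.min (hb'.sub hτ))).mono e1
    have key : ∀ A B, max a (a' - τ) ≤ A → B ≤ min b (b' - τ) → z ∈ Ico A B →
        ConjLe d (G + ((k + 1 : ℕ) : ℝ) * M) A → ConjLe d (G + ((k + 1 : ℕ) : ℝ) * M) B →
        (∀ x ∈ Ico A B, x + τ + τ' ∉ Ico u v) →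
        ∃ a b τ, z ∈ Ico a b ∧ Ico a b ⊆ Ico u v ∧ ConjLe d (G + ((k + 1 : ℕ) : ℝ) * M) a ∧
          ConjLe d (G + ((k + 1 : ℕ) : ℝ) * M) b ∧ ConjLe d (((k + 1 : ℕ) : ℝ) * M) τ ∧
          (∀ x ∈ Ico a b, (T ^ (k + 1)) x = x + τ) ∧
          ∀ x ∈ Ico a b, ∀ i, 1 ≤ i → i ≤ k + 1 → (T ^ i) x ∉ Ico u v := by
      intro A B hAm hBm hzAB hAc hBc hnot
      rw [max_le_iff] at hAm
      rw [le_min_iff] at hBm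
      have hin : ∀ x ∈ Ico A B, x ∈ Ico a b := fun x hx =>
        ⟨hAm.1.trans hx.1, hx.2.trans_le hBm.1⟩
      have htrs : ∀ x ∈ Ico A B, (T ^ (k + 1)) x = x + (τ + τ') := fun x hx => by
        rw [perm_pow_succ_apply, htr x (hin x hx),
          htr' _ ⟨by linarith [hx.1, hAm.2], by linarith [hx.2, hBm.2]⟩, add_assoc]
      refine ⟨A, B, τ + τ', hzAB, fun x hx => hsub (hin x hx), hAc, hBc, hττ.mono e2, htrs,
        fun x hx i h1 h2 => ?_⟩
      rcases h2.lt_or_eq with h2 | rfl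
      · exact hav x (hin x hx) i h1 (by omega)
      · rw [htrs x hx, ← add_assoc]
        exact hnot x hx
    have hzmax : max a (a' - τ) ≤ z := max_le hzab.1 (by linarith [hzab'.1])
    have hzmin : z < min b (b' - τ) := lt_min hzab.2 (by linarith [hzab'.2])
    rcases lt_or_ge (z + τ + τ') u with hlt | hge
    · refine key (max a (a' - τ)) (min (min b (b' - τ)) (u - (τ + τ'))) le_rfl
        (min_le_left _ _) ⟨hzmax, lt_min hzmin (by linarith)⟩ hA
        (hB.min ((hu.sub hττ).mono e3)) fun x hx hx' => ?_
      have h1 := hx.2.trans_le (min_le_right _ _)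
      linarith [hx'.1]
    · have hge' : v ≤ z + τ + τ' := by
        by_contra! hlt
        exact hzn ⟨hge, hlt⟩
      refine key (max (max a (a' - τ)) (v - (τ + τ'))) (min b (b' - τ)) (le_max_left _ _)
        le_rfl ⟨max_le hzmax (by linarith), hzmin⟩ (hA.max ((hv.sub hττ).mono e3)) hB
        fun x hx hx' => ?_
      have h1 := (le_max_right _ _).trans hx.1
      linarith [hx'.2]

end IsLocalTranslation

theorem sum_sub_le_of_pairwise_disjoint_Ico {l r : ℝ} (hlr : l ≤ r) (n : ℕ) (a b : ℕ → ℝ)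
    (hab : ∀ k < n, a k ≤ b k) (hsub : ∀ k < n, Ico (a k) (b k) ⊆ Ico l r)
    (hdisj : ∀ j < n, ∀ k < j, Disjoint (Ico (a k) (b k)) (Ico (a j) (b j))) :
    ∑ k ∈ Finset.range n, (b k - a k) ≤ r - l := by
  have hpd : (↑(Finset.range n) : Set ℕ).PairwiseDisjoint fun k => Ico (a k) (b k) := by
    intro i hi j hj hij
    rw [Finset.mem_coe, Finset.mem_range] at hi hj
    rcases lt_or_gt_of_ne hij with h | h
    · exact hdisj j hj i h
    · exact (hdisj i hi j h).symm
  have h1 := measure_biUnion_finset (μ := volume) hpd fun k _ => measurableSet_Ico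
  have h2 : volume (⋃ k ∈ Finset.range n, Ico (a k) (b k)) ≤ volume (Ico l r) :=
    measure_mono (iUnion₂_subset fun k hk => hsub k (Finset.mem_range.1 hk))
  simp only [Real.volume_Ico] at h1 h2
  rw [h1, ← ENNReal.ofReal_sum_of_nonneg fun k hk =>
    sub_nonneg.2 (hab k (Finset.mem_range.1 hk))] at h2
  exact (ENNReal.ofReal_le_ofReal_iff (by linarith)).1 h2

/-- A bound on partial sums of a harmonic-type series bounds the number of terms. -/
theorem add_mul_le_mul_exp_of_sum_le {H M S : ℝ} (hH : 0 < H) (hM : 0 < M) (n : ℕ)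
    (h : ∑ k ∈ Finset.range n, 1 / (2 * (H + k * M)) ≤ S) :
    H + n * M ≤ H * Real.exp (2 * M * S) := by
  have hpos : ∀ k : ℕ, 0 < H + k * M := fun k => by positivity
  have hstep : ∀ k : ℕ, Real.log (H + ((k + 1 : ℕ) : ℝ) * M) - Real.log (H + k * M)
      ≤ 2 * M * (1 / (2 * (H + k * M))) := by
    intro k
    rw [← Real.log_div (hpos _).ne' (hpos _).ne']
    refine (Real.log_le_sub_one_of_pos (div_pos (hpos _) (hpos _))).trans (le_of_eq ?_)
    have := (hpos k).ne'
    push_cast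
    field_simp
    ring
  have h1 := Finset.sum_le_sum fun k (_ : k ∈ Finset.range n) => hstep k
  rw [Finset.sum_range_sub fun k : ℕ => Real.log (H + k * M), ← Finset.mul_sum] at h1
  have h2 : Real.log (H + n * M) ≤ Real.log H + 2 * M * S := by
    have := mul_le_mul_of_nonneg_left h (by positivity : 0 ≤ 2 * M)
    simp only [Nat.cast_zero, zero_mul, add_zero] at h1
    linarith
  calc H + n * M = Real.exp (Real.log (H + n * M)) := (Real.exp_log (hpos n)).symm
    _ ≤ Real.exp (Real.log H + 2 * M * S) := Real.exp_le_exp.2 h2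
    _ = H * Real.exp (2 * M * S) := by rw [Real.exp_add, Real.exp_log hH]

namespace IsLocalTranslation

variable {d : ℤ} {G M l r : ℝ} {T : Equiv.Perm ℝ}

/-- A point of `[u,v)` returns to `[u,v)` within a time proportional to the conjugates of
the endpoints. -/
theorem mul_le_of_forall_notMem (hirr : Irrational √(d : ℝ)) (hd : 0 ≤ d)
    (hT : IsLocalTranslation d G M l r T) (hG : 0 < G) (hM : 0 < M) {u v z : ℝ}
    (hl : l ≤ u) (hr : v ≤ r) (hu : ConjLe d G u) (hv : ConjLe d G v) (hz : z ∈ Ico u v)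
    (N : ℕ) (hN : ∀ i, 1 ≤ i → i ≤ N → (T ^ i) z ∉ Ico u v) :
    G + ((N + 1 : ℕ) : ℝ) * M ≤ G * Real.exp (2 * M * (r - l)) := by
  have hex : ∀ k : ℕ, ∃ a b τ, k ≤ N → (z ∈ Ico a b ∧ Ico a b ⊆ Ico u v ∧
      ConjLe d (G + k * M) a ∧ ConjLe d (G + k * M) b ∧ ConjLe d (k * M) τ ∧
      (∀ x ∈ Ico a b, (T ^ k) x = x + τ) ∧
      ∀ x ∈ Ico a b, ∀ i, 1 ≤ i → i ≤ k → (T ^ i) x ∉ Ico u v) := by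
    intro k
    by_cases hk : k ≤ N
    · obtain ⟨a, b, τ, h⟩ := hT.exists_avoiding_Ico hl hr hu hv hz k
        fun i h1 h2 => hN i h1 (h2.trans hk)
      exact ⟨a, b, τ, fun _ => h⟩
    · exact ⟨0, 0, 0, fun h => absurd h hk⟩
  choose a b τ h using hex
  have hpre : ∀ k ≤ N, ∀ y ∈ Ico (a k + τ k) (b k + τ k),
      y - τ k ∈ Ico (a k) (b k) ∧ (T ^ k) (y - τ k) = y := by
    intro k hk y hy
    have hm : y - τ k ∈ Ico (a k) (b k) := ⟨by linarith [hy.1], by linarith [hy.2]⟩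
    exact ⟨hm, by rw [(h k hk).2.2.2.2.2.1 _ hm]; ring⟩
  have hsum := sum_sub_le_of_pairwise_disjoint_Ico (l := l) (r := r)
    (by linarith [hz.1, hz.2]) (N + 1) (fun k => a k + τ k) (fun k => b k + τ k) ?_ ?_ ?_
  · refine add_mul_le_mul_exp_of_sum_le hG hM (N + 1)
      ((Finset.sum_le_sum fun k hk => ?_).trans hsum)
    obtain ⟨hzab, -, ha, hb, -⟩ := h k (by rw [Finset.mem_range] at hk; omega)
    have hlt : a k < b k := hzab.1.trans_lt hzab.2
    have h1 := ConjLe.one_le_abs_mul hirr hd (sub_ne_zero.2 hlt.ne') (hb.sub ha)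
    rw [abs_of_pos (by linarith)] at h1
    have h2 : 0 < G + k * M := by positivity
    rw [div_le_iff₀ (by positivity)]
    linarith
  · intro k hk
    obtain ⟨hzab, -⟩ := h k (by omega)
    linarith [hzab.1, hzab.2]
  · intro k hk y hy
    obtain ⟨h1, h2⟩ := hpre k (by omega) y hy
    have h3 := (h k (by omega)).2.1 h1
    rw [← h2, hT.pow_mem_iff]
    exact ⟨hl.trans h3.1, h3.2.trans_le hr⟩
  · intro j hj k hkj
    refine Set.disjoint_left.2 fun y hyk hyj => ?_
    obtain ⟨h1, h2⟩ := hpre k (by omega) y hyk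
    obtain ⟨h3, h4⟩ := hpre j (by omega) y hyj
    refine (h j (by omega)).2.2.2.2.2.2 _ h3 (j - k) (by omega) (by omega) ?_
    have h5 : (T ^ k) ((T ^ (j - k)) (y - τ j)) = (T ^ k) (y - τ k) := by
      rw [← Equiv.Perm.mul_apply, ← pow_add, Nat.add_sub_cancel' hkj.le, h4, h2]
    rw [(T ^ k).injective h5]
    exact (h k (by omega)).2.1 h1

/-- Every point of `[l,r)` enters `[u,v)` within a time proportional to the conjugates of
the endpoints. -/
theorem exists_pow_mem (hirr : Irrational √(d : ℝ)) (hd : 0 ≤ d)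
    (hT : IsLocalTranslation d G M l r T) (hT' : IsLocalTranslation d G M l r T⁻¹)
    (hmin : IsMinimalOn T l r) (hG : 0 < G) (hM : 0 < M) {u v : ℝ} (huv : u < v)
    (hl : l ≤ u) (hr : v ≤ r) (hu : ConjLe d G u) (hv : ConjLe d G v) (N : ℕ)
    (hN : G * Real.exp (2 * M * (r - l)) < G + ((N + 1 : ℕ) : ℝ) * M)
    {z : ℝ} (hz : z ∈ Ico l r) : ∃ i, 1 ≤ i ∧ i ≤ N ∧ (T ^ i) z ∈ Ico u v := by
  have hret : ∀ y ∈ Ico u v, ∃ i, 1 ≤ i ∧ i ≤ N ∧ (T ^ i) y ∈ Ico u v := by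
    intro y hy
    by_contra! hcon
    exact hN.not_ge (hT.mul_le_of_forall_notMem hirr hd hG hM hl hr hu hv hy N hcon)
  have hret' : ∀ y ∈ Ico u v, ∃ i, 1 ≤ i ∧ i ≤ N ∧ (T⁻¹ ^ i) y ∈ Ico u v := by
    intro y hy
    by_contra! hcon
    exact hN.not_ge (hT'.mul_le_of_forall_notMem hirr hd hG hM hl hr hu hv hy N hcon)
  by_contra! hcon
  have hback : ∀ m : ℕ, (T⁻¹ ^ m) z ∉ Ico u v := by
    classical
    intro m hm
    have hex : ∃ m : ℕ, (T⁻¹ ^ m) z ∈ Ico u v := ⟨m, hm⟩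
    obtain ⟨i, h1, h2, h3⟩ := hret _ (Nat.find_spec hex)
    have hmin' := fun k => Nat.find_min (m := k) hex
    set m₀ := Nat.find hex
    rcases le_or_gt i m₀ with hi | hi
    · refine hmin' (m₀ - i) (by omega) ?_
      convert h3 using 1
      obtain ⟨j, hj⟩ := Nat.exists_eq_add_of_le hi
      rw [hj, Nat.add_sub_cancel_left, pow_add, Equiv.Perm.mul_apply, inv_pow T i,
        perm_apply_inv_self]
    · refine hcon (i - m₀) (by omega) (by omega) ?_
      convert h3 using 1
      obtain ⟨j, hj⟩ := Nat.exists_eq_add_of_le hi.le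
      rw [hj, Nat.add_sub_cancel_left, add_comm, pow_add, Equiv.Perm.mul_apply, inv_pow T m₀,
        perm_apply_inv_self]
  have hfwd : ∃ n : ℕ, (T ^ n) z ∈ Ico u v := by
    have hmid : (u + v) / 2 ∈ closure (orbitZ T z) :=
      hmin z hz ⟨by linarith, by linarith⟩
    obtain ⟨w, hw, n, rfl⟩ := mem_closure_iff.1 hmid (Ioo u v) isOpen_Ioo
      ⟨by linarith, by linarith⟩
    obtain ⟨n, rfl | rfl⟩ := n.eq_nat_or_neg
    · exact ⟨n, by simpa using Ioo_subset_Ico_self hw⟩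
    · exact absurd (by simpa using Ioo_subset_Ico_self hw) (hback n)
  classical
  obtain ⟨i, h1, h2, h3⟩ := hret' _ (Nat.find_spec hfwd)
  have hmin' := fun k => Nat.find_min (m := k) hfwd
  set n₀ := Nat.find hfwd
  rcases le_or_gt i n₀ with hi | hi
  · refine hmin' (n₀ - i) (by omega) ?_
    convert h3 using 1
    obtain ⟨j, hj⟩ := Nat.exists_eq_add_of_le hi
    rw [hj, Nat.add_sub_cancel_left, pow_add, Equiv.Perm.mul_apply, inv_pow T i,
      perm_inv_apply_self]
  · refine hback (i - n₀) ?_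
    convert h3 using 1
    obtain ⟨j, hj⟩ := Nat.exists_eq_add_of_le hi.le
    rw [hj, Nat.add_sub_cancel_left, add_comm, pow_add, Equiv.Perm.mul_apply, inv_pow T n₀,
      perm_inv_apply_self]

end IsLocalTranslation

theorem sepPt_add_len {s : ℕ} (l : ℝ) (len : Fin s → ℝ) (i : Fin s) :
    sepPt l len i + len i = l + ∑ j ∈ Finset.univ.filter (fun j => j ≤ i), len j := by
  have h : Finset.univ.filter (fun j => j ≤ i)
      = insert i (Finset.univ.filter (fun j => j < i)) := by
    ext j
    simp [le_iff_eq_or_lt]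
  rw [h, Finset.sum_insert (by simp), sepPt]
  ring

theorem sepPt_add_len_eq {s : ℕ} {l r : ℝ} {len : Fin s → ℝ} (h : ∑ i, len i = r - l)
    (i : Fin s) :
    sepPt l len i + len i = r ∨ ∃ j, i < j ∧ sepPt l len i + len i = sepPt l len j := by
  rw [sepPt_add_len]
  by_cases hi : (i : ℕ) + 1 < s
  · refine Or.inr ⟨⟨i + 1, hi⟩, Fin.lt_def.2 (Nat.lt_succ_self _), ?_⟩
    have hfil : Finset.univ.filter (fun j => j ≤ i)
        = Finset.univ.filter (fun j : Fin s => j < ⟨i + 1, hi⟩) :=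
      Finset.filter_congr fun j _ => by rw [Fin.lt_def, Fin.le_def]; exact Nat.lt_succ_iff.symm
    rw [sepPt, hfil]
  · left
    have hfil : Finset.univ.filter (fun j => j ≤ i) = Finset.univ :=
      Finset.filter_true_of_mem fun j _ => Fin.le_def.2 (by omega)
    rw [hfil, h, add_sub_cancel]

theorem exists_mem_Ico_sepPt {s : ℕ} {l r : ℝ} {len : Fin s → ℝ}
    (h : ∑ i, len i = r - l) {z : ℝ} (hz : z ∈ Ico l r) :
    ∃ i, z ∈ Ico (sepPt l len i) (sepPt l len i + len i) := by
  have hs : 0 < s := by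
    rcases Nat.eq_zero_or_pos s with rfl | hs
    · simp at h
      linarith [hz.1, hz.2]
    · exact hs
  have h0 : sepPt l len ⟨0, hs⟩ = l := by
    simp [sepPt, Fin.lt_def]
  obtain ⟨i, hi, hmax⟩ := (Finset.univ.filter fun i => sepPt l len i ≤ z).exists_max_image id
    ⟨⟨0, hs⟩, by simpa [h0] using hz.1⟩
  refine ⟨i, by simpa using hi, ?_⟩
  rcases sepPt_add_len_eq h i with hr | ⟨j, hij, hj⟩
  · rw [hr]; exact hz.2
  · rw [hj]
    by_contra! hle
    exact hij.not_ge (hmax j (by simpa using hle))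

theorem exists_isLocalTranslation {d : ℤ} {s : ℕ} {l r : ℝ} {len : Fin s → ℝ}
    {π : Equiv.Perm (Fin s)} {T : Equiv.Perm ℝ} (hIET : IsIET s l r len π T)
    (hdef : DefinedOverZ d s l r len π) :
    ∃ G M, 0 < G ∧ 0 < M ∧ IsLocalTranslation d G M l r T := by
  obtain ⟨-, -, hsum, hid, htr⟩ := hIET
  obtain ⟨-, hr, hpts⟩ := hdef
  have hend : ∀ i, sepPt l len i + len i ∈ Zsd d := fun i => by
    rcases sepPt_add_len_eq hsum i with h | ⟨j, -, h⟩ <;> rw [h]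
    exacts [hr, (hpts j).1]
  choose A hA using fun i => ConjLe.exists_of_mem_Zsd (hpts i).1
  choose B hB using fun i => ConjLe.exists_of_mem_Zsd (hend i)
  choose C hC using fun i => ConjLe.exists_of_mem_Zsd (hpts i).2
  obtain ⟨a, ha⟩ := (Finset.univ.image A).exists_le
  obtain ⟨b, hb⟩ := (Finset.univ.image B).exists_le
  obtain ⟨c, hc⟩ := (Finset.univ.image C).exists_le
  have hle : ∀ (F : Fin s → ℝ) (m : ℝ), (∀ x ∈ Finset.univ.image F, x ≤ m) → ∀ i, F i ≤ m :=
    fun F m h i => h _ (Finset.mem_image_of_mem F (Finset.mem_univ i))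
  refine ⟨max 1 (max a b), max 1 c, by positivity, by positivity, fun z => ?_, fun z hz => ?_⟩
  · by_cases hz : z ∈ Ico l r
    · refine iff_of_true ?_ hz
      by_contra hTz
      rw [T.injective (hid _ hTz)] at hTz
      exact hTz hz
    · rw [hid z hz]
  · obtain ⟨i, hi⟩ := exists_mem_Ico_sepPt hsum hz
    exact ⟨_, _, _, hi,
      (hA i).mono ((hle A a ha i).trans ((le_max_left _ _).trans (le_max_right _ _))),
      (hB i).mono ((hle B b hb i).trans ((le_max_right _ _).trans (le_max_right _ _))),
      (hC i).mono ((hle C c hc i).trans (le_max_right _ _)), htr i⟩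

theorem IsMinimalOn.pow_apply_ne {T : Equiv.Perm ℝ} {l r : ℝ} (hlr : l < r)
    (hmin : IsMinimalOn T l r) {z : ℝ} (hz : z ∈ Ico l r) {n : ℕ} (hn : 0 < n) :
    (T ^ n) z ≠ z := by
  intro hper
  have hfin : (orbitZ T z).Finite := by
    refine (((Finset.range n).image fun k : ℕ => (T ^ k) z).finite_toSet).subset ?_
    rintro w ⟨k, rfl⟩
    have hn' : (n : ℤ) ≠ 0 := by omega
    have hper' : (T ^ (n : ℤ)) z = z := by rwa [zpow_natCast]
    have hk : (T ^ k) z = (T ^ (k % n)) z := by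
      conv_lhs => rw [← Int.emod_add_mul_ediv k n, zpow_add, zpow_mul, Equiv.Perm.mul_apply,
        Equiv.Perm.zpow_apply_eq_self_of_apply_eq_self hper']
    obtain ⟨j, hj⟩ := Int.eq_ofNat_of_zero_le (Int.emod_nonneg k hn')
    have hlt := Int.emod_lt_of_pos k (by omega : (0 : ℤ) < n)
    simp only [Finset.coe_image, Finset.coe_range, mem_image, mem_Iio]
    exact ⟨j, by omega, by rw [hk, hj, zpow_natCast]⟩
  have hsub := hmin z hz
  rw [hfin.isClosed.closure_eq] at hsub
  exact (Ico_infinite hlr) (hfin.subset hsub)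

theorem IsLocalTranslation.one_le_mul_of_pow_mem {d : ℤ} {G M l r : ℝ} {T : Equiv.Perm ℝ}
    (hirr : Irrational √(d : ℝ)) (hd : 0 ≤ d) (hT : IsLocalTranslation d G M l r T)
    (hlr : l < r) (hmin : IsMinimalOn T l r) (hM : 0 < M) {u v z : ℝ}
    (hsub : Ico u v ⊆ Ico l r) (hz : z ∈ Ico u v) {n : ℕ} (hn : 0 < n)
    (hzn : (T ^ n) z ∈ Ico u v) : 1 ≤ n * (M * (v - u)) := by
  have h := ConjLe.one_le_abs_mul hirr hd
    (sub_ne_zero.2 (hmin.pow_apply_ne hlr (hsub hz) hn)) (hT.conjLe_pow_sub (hsub hz) n)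
  have h2 : |(T ^ n) z - z| ≤ v - u :=
    abs_le.2 ⟨by linarith [hz.2, hzn.1], by linarith [hz.1, hzn.2]⟩
  calc (1 : ℝ) ≤ |(T ^ n) z - z| * (n * M) := h
    _ ≤ (v - u) * (n * M) := by gcongr
    _ = n * (M * (v - u)) := by ring

/-- Every point of `[l,r)` enters a semi-interval `[u,v)` within time `O(1/(v-u))`. -/
theorem IsLocalTranslation.exists_uniform_hitting_time {d : ℤ} {G M l r : ℝ}
    {T : Equiv.Perm ℝ} (hd : 2 ≤ d) (hsq : ¬ IsSquare d) (hirr : Irrational √(d : ℝ))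
    (hT : IsLocalTranslation d G M l r T) (hlr : l < r) (hmin : IsMinimalOn T l r)
    (hG : 0 < G) (hM : 0 < M) :
    ∃ c, ∀ u v, u < v → Ico u v ⊆ Ico l r → ∃ N : ℕ, (N : ℝ) ≤ c / (v - u) ∧
      ∀ z ∈ Ico l r, ∃ i, 1 ≤ i ∧ i ≤ N ∧ (T ^ i) z ∈ Ico u v := by
  obtain ⟨C, hC, hnear⟩ := exists_conjLe_near hd hsq l r
  refine ⟨((2 * C + (G + M) * (r - l)) * Real.exp (2 * M * (r - l))) / M,
    fun u v huv hsub => ?_⟩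
  obtain ⟨hl, hr⟩ := (Ico_subset_Ico_iff huv).1 hsub
  have hε : 0 < v - u := by linarith
  obtain ⟨p, hp, hp', hpc⟩ :=
    hnear ((v - u) / 2) (by linarith) (by linarith) ((u + v) / 2) ⟨by linarith, by linarith⟩
  obtain ⟨q, hq, hq', hqc⟩ :=
    hnear ((v - u) / 2) (by linarith) (by linarith) v ⟨by linarith, hr⟩
  set H := (2 * C + (G + M) * (r - l)) / (v - u) with hH
  have hCH : C / ((v - u) / 2) ≤ H := by
    rw [hH, div_div_eq_mul_div]
    gcongr
    have : 0 < (G + M) * (r - l) := mul_pos (by linarith) (by linarith)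
    linarith
  have hGH : G + M ≤ H := by
    rw [hH, le_div_iff₀ hε]
    have : (G + M) * (v - u) ≤ (G + M) * (r - l) := by gcongr
    linarith
  have hH0 : 0 < H := by linarith
  have hfloor := Nat.lt_floor_add_one (H * Real.exp (2 * M * (r - l)) / M)
  rw [div_lt_iff₀ hM] at hfloor
  refine ⟨⌊H * Real.exp (2 * M * (r - l)) / M⌋₊, ?_, fun z hz => ?_⟩
  · refine (Nat.floor_le (by positivity)).trans (le_of_eq ?_)
    rw [hH]
    field_simp
  · obtain ⟨i, h1, h2, h3⟩ := (hT.mono (by linarith : G ≤ H)).exists_pow_mem hirr (by omega)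
      (hT.inv.mono hGH) hmin hH0 hM (by linarith : p < q) (by linarith) (by linarith)
      (hpc.mono hCH) (hqc.mono hCH) _ (by push_cast; linarith) hz
    exact ⟨i, h1, h2, by linarith [h3.1], by linarith [h3.2]⟩

/-- For a minimal interval exchange transformation defined over
`ℤ[√d]`, all four return times of a semi-interval `J ⊆ [l,r)` with endpoints in
`ℤ[√d]` are `Θ(1/|J|)`, with constants depending only on `T`. -/
theorem return_times_theta (d : ℤ) (hd : 2 ≤ d) (hsf : Squarefree d)
    (s : ℕ) (l r : ℝ) (len : Fin s → ℝ) (π : Equiv.Perm (Fin s)) (T : Equiv.Perm ℝ)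
    (hIET : IsIET s l r len π T) (hmin : IsMinimalOn T l r)
    (hdef : DefinedOverZ d s l r len π) :
    ∃ c₁ c₂ : ℝ, 0 < c₁ ∧ c₁ ≤ c₂ ∧
      ∀ u v : ℝ, u < v → Set.Ico u v ⊆ Set.Ico l r → u ∈ Zsd d → v ∈ Zsd d →
        (c₁ / (v - u) ≤ (rhoPlusSet T (Set.Ico u v) : ℝ) ∧
          (rhoPlusSet T (Set.Ico u v) : ℝ) ≤ c₂ / (v - u)) ∧
        (c₁ / (v - u) ≤ (rhoMinusSet T (Set.Ico u v) : ℝ) ∧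
          (rhoMinusSet T (Set.Ico u v) : ℝ) ≤ c₂ / (v - u)) ∧
        (c₁ / (v - u) ≤ (sigmaPlusSet T (Set.Ico u v) : ℝ) ∧
          (sigmaPlusSet T (Set.Ico u v) : ℝ) ≤ c₂ / (v - u)) ∧
        (c₁ / (v - u) ≤ (sigmaMinusSet T (Set.Ico u v) : ℝ) ∧
          (sigmaMinusSet T (Set.Ico u v) : ℝ) ≤ c₂ / (v - u)) := by
  have hsq : ¬ IsSquare d := by
    rintro ⟨a, rfl⟩
    rcases Int.isUnit_iff.1 (hsf a dvd_rfl) with rfl | rfl <;> omega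
  have hd0 : 0 ≤ d := by omega
  have hirr : Irrational √(d : ℝ) := irrational_sqrt_intCast_iff.2 ⟨hsq, hd0⟩
  have hlr := hIET.1
  obtain ⟨G, M, hG, hM, hT⟩ := exists_isLocalTranslation hIET hdef
  obtain ⟨c, hc⟩ := hT.exists_uniform_hitting_time hd hsq hirr hlr hmin hG hM
  refine ⟨1 / (2 * M), max (1 / (2 * M)) c, by positivity, le_max_left _ _, ?_⟩
  intro u v huv hsub _ _
  obtain ⟨N, hNc, hN⟩ := hc u v huv hsub
  have hε : 0 < v - u := by linarith
  have hu : u ∈ Ico u v := ⟨le_rfl, huv⟩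
  have hbounds : ∀ S : Set ℕ, (∃ m ≤ N, m ∈ S) →
      (∀ n ∈ S, ∃ z ∈ Ico u v, ∃ m, 0 < m ∧ m ≤ 2 * n ∧ (T ^ m) z ∈ Ico u v) →
      1 / (2 * M) / (v - u) ≤ ((sInf S : ℕ) : ℝ) ∧
        ((sInf S : ℕ) : ℝ) ≤ max (1 / (2 * M)) c / (v - u) := by
    rintro S ⟨m₀, hm₀N, hm₀⟩ hS
    constructor
    · obtain ⟨z, hz, m, hm, hmn, hzm⟩ := hS _ (Nat.sInf_mem ⟨m₀, hm₀⟩)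
      have h1 := hT.one_le_mul_of_pow_mem hirr hd0 hlr hmin hM hsub hz hm hzm
      have h2 : (m : ℝ) ≤ 2 * (sInf S : ℕ) := by exact_mod_cast hmn
      have h3 : 0 < M * (v - u) := by positivity
      rw [div_div, div_le_iff₀ (by positivity)]
      nlinarith [mul_le_mul_of_nonneg_right h2 h3.le]
    · calc ((sInf S : ℕ) : ℝ) ≤ N := by exact_mod_cast (Nat.sInf_le hm₀).trans hm₀N
        _ ≤ c / (v - u) := hNc
        _ ≤ max (1 / (2 * M)) c / (v - u) := by
          gcongr
          exact le_max_right _ _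
  have hsplit : ∀ (i j : ℕ) (z : ℝ), (T ^ i) ((T ^ j) z) = (T ^ (i + j)) z := fun i j z => by
    rw [pow_add, Equiv.Perm.mul_apply]
  have hinv : ∀ (i : ℕ) (z : ℝ), (T ^ i) ((T⁻¹ ^ i) z) = z := fun i z => by
    rw [inv_pow, perm_apply_inv_self]
  have hinv' : ∀ (i : ℕ) (z : ℝ), (T⁻¹ ^ i) ((T ^ i) z) = z := fun i z => by
    rw [inv_pow, perm_inv_apply_self]
  obtain ⟨i₀, hi₀, hi₀N, hui₀⟩ := hN u (hsub hu)
  have hN1 : 1 ≤ N := hi₀.trans hi₀N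
  refine ⟨hbounds _ ⟨N, le_rfl, hN1, ?_⟩ ?_, hbounds _ ⟨N, le_rfl, hN1, ?_⟩ ?_,
    hbounds _ ⟨i₀, hi₀N, hi₀, _, ⟨u, hu, rfl⟩, hui₀⟩ ?_,
    hbounds _ ⟨i₀, hi₀N, hi₀, u, ⟨_, hui₀, hinv' i₀ u⟩, hu⟩ ?_⟩
  · rintro _ ⟨z, hz, rfl⟩
    obtain ⟨i, h1, h2, h3⟩ := hN z (hsub hz)
    refine mem_iUnion₂.2 ⟨N - i, Finset.mem_range.2 (by omega), _, h3, ?_⟩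
    rw [hsplit, Nat.sub_add_cancel h2]
  · rintro n ⟨hn, hsubn⟩
    obtain ⟨i, hi, y, hy, hyu⟩ := mem_iUnion₂.1 (hsubn ⟨u, hu, rfl⟩)
    rw [Finset.mem_range] at hi
    refine ⟨u, hu, n - i, by omega, by omega, ?_⟩
    rw [← Nat.add_sub_cancel' hi.le, ← hsplit] at hyu
    rwa [← (T ^ i).injective hyu]
  · rintro _ ⟨z, hz, rfl⟩
    obtain ⟨i, h1, h2, h3⟩ := hN ((T ^ (N - 1)) z) ((hT.pow_mem_iff _ _).2 (hsub hz))
    refine mem_iUnion₂.2 ⟨i - 1, Finset.mem_range.2 (by omega), _, h3, ?_⟩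
    rw [hsplit, show i + (N - 1) = i - 1 + N by omega, ← hsplit, hinv']
  · rintro n ⟨hn, hsubn⟩
    obtain ⟨i, hi, y, hy, hyu⟩ := mem_iUnion₂.1 (hsubn ⟨u, hu, rfl⟩)
    rw [Finset.mem_range] at hi
    refine ⟨u, hu, i + n, by omega, by omega, ?_⟩
    rwa [← hsplit, ← hyu, hinv]
  · rintro n ⟨hn, _, ⟨z, hz, rfl⟩, hzn⟩
    exact ⟨z, hz, n, hn, by omega, hzn⟩
  · rintro n ⟨hn, _, ⟨z, hz, rfl⟩, hzn⟩
    exact ⟨_, hzn, n, hn, by omega, by rwa [hinv]⟩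

end
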